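/- Let K be a field, let n ≥ 3 be an integer, and let a, b ∈ K with a·b ≠ 0. Then for every integer k ≥ 2 there exist rational functions X₁, …, X_k, U in the rational function field K(t), with at least one X_j nonconstant, such that U² = ∏_{j=1}^{k} (X_j^n + a·X_j + b) holds in K(t). (That is, the hypersurface S_k¹ : u² = ∏_{j=1}^{k} g₁(x_j) contains a rational curve.) -/

import Mathlib

theorem ratX_ne_C (K : Type*) [Field K] (c : K) : (RatFunc.X : RatFunc K) ≠ RatFunc.C c := by
  rw [← RatFunc.algebraMap_X, ← RatFunc.algebraMap_C]
  intro h
  exact Polynomial.X_ne_C c (RatFunc.algebraMap_injective K h)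

theorem trinomial_pow_ne (K : Type*) [Field K] (n : ℕ) (hn : 3 ≤ n) (a b : K) (T : RatFunc K)
    (hT : T = RatFunc.X ^ n + RatFunc.C a * RatFunc.X + RatFunc.C b) : T ^ n ≠ T := by
  have hp : T = algebraMap (Polynomial K) (RatFunc K)
      (Polynomial.X ^ n + Polynomial.C a * Polynomial.X + Polynomial.C b) := by
    rw [hT]; simp
  have hd : (Polynomial.X ^ n + Polynomial.C a * Polynomial.X + Polynomial.C b).natDegree = n := by
    have h1 : (Polynomial.C a * Polynomial.X + Polynomial.C b).natDegree < n :=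
      lt_of_le_of_lt (Polynomial.natDegree_linear_le) (by omega)
    rw [add_assoc, Polynomial.natDegree_add_eq_left_of_natDegree_lt]
    · simp
    · simpa using h1
  rw [hp, ← map_pow]
  intro h
  have h2 := congrArg Polynomial.natDegree (RatFunc.algebraMap_injective K h)
  rw [Polynomial.natDegree_pow, hd] at h2
  nlinarith

/-- For every `k ≥ 2` the hypersurface `S_k¹ : u² = ∏_{j=1}^k g₁(x_j)`,
with `g₁(x) = x^n + a·x + b`, contains a rational curve: there are rational functions
`X₁, …, X_k, U ∈ K(t)`, at least one `X_j` nonconstant, with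
`U² = ∏_j (X_j^n + a·X_j + b)`. -/
theorem rational_curve_on_Sk1 (K : Type*) [Field K] (n : ℕ) (hn : 3 ≤ n)
    (a b : K) (hab : a * b ≠ 0) (k : ℕ) (hk : 2 ≤ k) :
    ∃ (X : Fin k → RatFunc K) (U : RatFunc K),
      (∃ j, ∀ c : K, X j ≠ RatFunc.C c) ∧
      U ^ 2 = ∏ j, (X j ^ n + RatFunc.C a * X j + RatFunc.C b) := by
  have ha : a ≠ 0 := left_ne_zero_of_mul hab
  have hA : (RatFunc.C a : RatFunc K) ≠ 0 := by simpa using ha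
  obtain ⟨T, hT⟩ : ∃ T : RatFunc K,
    T = RatFunc.X ^ n + RatFunc.C a * RatFunc.X + RatFunc.C b := ⟨_, rfl⟩
  have hTn := trinomial_pow_ne K n hn a b T hT
  rcases Nat.even_or_odd k with hke | hko
  · obtain ⟨r, rfl⟩ := hke
    refine ⟨fun _ => RatFunc.X, T ^ r, ⟨⟨0, by omega⟩, fun c => ratX_ne_C K c⟩, ?_⟩
    simp [← hT]
    ring
  obtain ⟨r, hr⟩ := hko
  obtain ⟨m, rfl⟩ : ∃ m, k = m + 1 + 1 + 1 := ⟨k - 3, by omega⟩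
  rcases Nat.even_or_odd n with hne | hno
  · obtain ⟨s, hs⟩ := hne
    refine ⟨Fin.cons (-(RatFunc.C b / RatFunc.C a)) (fun _ => RatFunc.X),
      (-(RatFunc.C b / RatFunc.C a)) ^ s * T ^ r, ⟨1, fun c => ratX_ne_C K c⟩, ?_⟩
    rw [Fin.prod_univ_succ]
    have h0 : RatFunc.C a * (-(RatFunc.C b / RatFunc.C a)) = -RatFunc.C b := by
      field_simp
    simp only [Fin.cons_zero, Fin.cons_succ, h0, ← hT, Finset.prod_const, Finset.card_univ,
      Fintype.card_fin]
    rw [show m + 1 + 1 = r + r by omega, hs, pow_add, pow_add]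
    ring
  · obtain ⟨s, hs⟩ := hno
    obtain ⟨x, hx⟩ : ∃ x : RatFunc K,
        RatFunc.C a * (T - T ^ n) * x = RatFunc.C b * (T ^ n - 1) :=
      ⟨RatFunc.C b * (T ^ n - 1) / (RatFunc.C a * (T - T ^ n)), by
        rw [mul_div_cancel₀]
        exact mul_ne_zero hA (sub_ne_zero.mpr hTn.symm)⟩
    refine ⟨Fin.cons x (Fin.cons (T * x) (fun _ => RatFunc.X)),
      (x ^ n + RatFunc.C a * x + RatFunc.C b) * T ^ (s + r), ⟨2, fun c => ratX_ne_C K c⟩, ?_⟩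
    have h0 : (T * x) ^ n + RatFunc.C a * (T * x) + RatFunc.C b
        = T ^ n * (x ^ n + RatFunc.C a * x + RatFunc.C b) := by
      rw [mul_pow]
      linear_combination hx
    rw [Fin.prod_univ_succ, Fin.prod_univ_succ]
    simp only [Fin.cons_zero, Fin.cons_succ, h0, ← hT, Finset.prod_const, Finset.card_univ,
      Fintype.card_fin]
    have h1 : (T ^ (s + r)) ^ 2 = T ^ n * T ^ (m + 1) := by
      rw [← pow_mul, ← pow_add]
      congr 1
      omega
    rw [mul_pow, h1]
    ring
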